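/- Let Λ be the differential operator x·(d/dx)² on the one-variable polynomial ring ℂ[x] (i.e., Λ(f) = x·f'' ), and let P(x) = x. Then P is Λ-nilpotent, i.e., Λ^m(x^m) = 0 for all m ≥ 1, but Λ^m(x^{m+1}) ≠ 0 for every m ≥ 1. In particular, the Vanishing Conjecture fails for differential operators with non-constant coefficients. -/

import Mathlib

/-- The operator `Λ = x (d/dx)²` on `ℂ[x]`. -/
noncomputable def Lam : Module.End ℂ (Polynomial ℂ) :=
  (LinearMap.mulLeft ℂ (Polynomial.X : Polynomial ℂ)) ∘ₗ
    ((Polynomial.derivative : Polynomial ℂ →ₗ[ℂ] Polynomial ℂ) ∘ₗ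
      (Polynomial.derivative : Polynomial ℂ →ₗ[ℂ] Polynomial ℂ))

theorem Lam_X_pow_succ (n : ℕ) :
    Lam ((Polynomial.X : Polynomial ℂ) ^ (n + 1)) =
      (((n + 1) * n : ℕ) : ℂ) • (Polynomial.X : Polynomial ℂ) ^ n := by
  rcases n with _ | n
  · simp [Lam]
  · simp [Lam, Polynomial.smul_eq_C_mul]
    ring

theorem Lam_pow_X_pow_succ (m : ℕ) :
    (Lam ^ m) ((Polynomial.X : Polynomial ℂ) ^ (m + 1)) =
      (((m + 1).factorial * m.factorial : ℕ) : ℂ) • (Polynomial.X : Polynomial ℂ) := by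
  induction m with
  | zero => simp
  | succ m ih =>
    rw [pow_succ, Module.End.mul_apply, Lam_X_pow_succ, map_smul, ih, smul_smul,
      ← Nat.cast_mul, Nat.factorial_succ (m + 1), Nat.factorial_succ m]
    congr 2
    ring

/-- De Bondt's counterexample: `P(x) = x` is `Λ`-nilpotent for `Λ = x (d/dx)²`, yet
`Λ^m(P^{m+1}) ≠ 0` for all `m ≥ 1`. -/
theorem stmt8 :
    (∀ m : ℕ, 1 ≤ m → (Lam ^ m) ((Polynomial.X : Polynomial ℂ) ^ m) = 0) ∧
    (∀ m : ℕ, 1 ≤ m → (Lam ^ m) ((Polynomial.X : Polynomial ℂ) ^ (m + 1)) ≠ 0) := by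
  refine ⟨fun m hm => ?_, fun m _ => ?_⟩
  · obtain ⟨k, rfl⟩ := Nat.exists_eq_add_of_le' hm
    rw [pow_succ', Module.End.mul_apply, Lam_pow_X_pow_succ, map_smul]
    simp [Lam]
  · rw [Lam_pow_X_pow_succ]
    exact smul_ne_zero
      (Nat.cast_ne_zero.mpr (mul_ne_zero (Nat.factorial_ne_zero _) (Nat.factorial_ne_zero _)))
      Polynomial.X_ne_zero
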